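/- For any finite set A of real numbers and any x ∈ ℝ, |(A+x)(A+A)| · |A+A| ≫ |A|³ / log|A|, provided 0 ∉ A + x. -/

import Mathlib

open Finset Pointwise

lemma fiber_count {α β : Type*} [DecidableEq α] [DecidableEq β] (P : Finset α) (f h : α → β)
    (V : Finset β) (hV : ∀ p ∈ P, f p ∈ V) :
    #{z ∈ P ×ˢ P | f z.1 = h z.2} = ∑ s ∈ V, #{p ∈ P | f p = s} * #{p ∈ P | h p = s} := by
  rw [Finset.card_eq_sum_card_fiberwise (f := fun z => f z.1) (t := V)]
  · refine Finset.sum_congr rfl fun s _ => ?_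
    rw [← Finset.card_product]
    congr 1
    ext z
    simp only [mem_filter, mem_product]
    constructor
    · rintro ⟨⟨⟨h1, h2⟩, h3⟩, h4⟩
      exact ⟨⟨h1, h4⟩, h2, h3 ▸ h4⟩
    · rintro ⟨⟨h1, h4⟩, h2, h3⟩
      exact ⟨⟨⟨h1, h2⟩, h4.trans h3.symm⟩, h4⟩
  · intro z hz
    simp only [coe_filter, mem_product, Set.mem_ofPred_eq] at hz
    exact hV _ hz.1.1

lemma cs_count {α β : Type*} [DecidableEq α] [DecidableEq β] (P : Finset α) (f : α → β)
    (V : Finset β) (hV : ∀ p ∈ P, f p ∈ V) :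
    #P ^ 2 ≤ #V * #{z ∈ P ×ˢ P | f z.1 = f z.2} := by
  rw [fiber_count P f f V hV, Finset.card_eq_sum_card_fiberwise (f := f) (t := V) hV]
  simp only [← pow_two]
  exact sq_sum_le_card_mul_sum_sq

lemma cs_label {α β : Type*} [DecidableEq α] [DecidableEq β] (P : Finset α) (g : α → β)
    (l : α → ℕ) (L : ℕ) (hl : ∀ p ∈ P, l p < L) :
    #{z ∈ P ×ˢ P | g z.1 = g z.2} ≤ L * #{z ∈ P ×ˢ P | g z.1 = g z.2 ∧ l z.1 = l z.2} := by
  rw [fiber_count P g g (P.image g) (fun p hp => mem_image_of_mem _ hp),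
    Finset.card_eq_sum_card_fiberwise (s := {z ∈ P ×ˢ P | g z.1 = g z.2 ∧ l z.1 = l z.2})
      (f := fun z => g z.1) (t := P.image g), Finset.mul_sum]
  · refine Finset.sum_le_sum fun s _ => ?_
    have := cs_count {p ∈ P | g p = s} l (range L) (by
      intro p hp; simp only [mem_filter] at hp; exact mem_range.2 (hl p hp.1))
    rw [card_range] at this
    rw [← pow_two]
    refine this.trans (Nat.mul_le_mul_left _ (card_le_card ?_))
    intro z
    simp only [mem_filter, mem_product]
    rintro ⟨⟨⟨h1, h2⟩, h3, h4⟩, h5⟩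
    exact ⟨⟨⟨h1, h3⟩, h2.trans h4.symm, h5⟩, h2⟩
  · intro z hz
    simp only [coe_filter, mem_product, Set.mem_ofPred_eq] at hz
    exact mem_coe.2 (mem_image_of_mem _ hz.1.1)

lemma neg_count {α : Type*} [DecidableEq α] (P : Finset α) (g : α → ℝ) :
    #{z ∈ P ×ˢ P | g z.1 = - g z.2} ≤ #{z ∈ P ×ˢ P | g z.1 = g z.2} := by
  have h1 := fiber_count P g (fun p => - g p) (P.image g ∪ P.image (fun p => - g p))
    (fun p hp => mem_union_left _ (mem_image_of_mem _ hp))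
  have h2 := fiber_count P g g (P.image g ∪ P.image (fun p => - g p))
    (fun p hp => mem_union_left _ (mem_image_of_mem _ hp))
  have h3 := fiber_count P (fun p => - g p) (fun p => - g p)
    (P.image g ∪ P.image (fun p => - g p))
    (fun p hp => mem_union_right _ (mem_image_of_mem (fun p => - g p) hp))
  simp only [neg_inj] at h3
  have h4 : 2 * #{z ∈ P ×ˢ P | g z.1 = - g z.2} ≤ 2 * #{z ∈ P ×ˢ P | g z.1 = g z.2} := by
    nth_rewrite 2 [two_mul]
    rw [h1]
    nth_rewrite 1 [h2]
    rw [h3, ← Finset.sum_add_distrib, Finset.mul_sum]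
    refine Finset.sum_le_sum fun s _ => ?_
    have := two_mul_le_add_sq (#{p ∈ P | g p = s}) (#{p ∈ P | - g p = s})
    nlinarith
  omega

lemma harm (f : ℝ → ℕ) (K : ℝ) (n : ℕ) : ∀ Q : Finset ℝ, #Q = n →
    (∀ Q' ⊆ Q, ∀ t : ℕ, (∀ q ∈ Q', t ≤ f q) → (#Q' : ℝ) * (t : ℝ) ^ 2 ≤ K) →
    ∑ q ∈ Q, (f q : ℝ) ^ 2 ≤ K * ((harmonic n : ℚ) : ℝ) := by
  induction n with
  | zero => intro Q hQ _; simp [Finset.card_eq_zero.1 hQ]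
  | succ n ih =>
    intro Q hQ h
    have hne : Q.Nonempty := card_pos.1 (by omega)
    obtain ⟨q, hq, hmin⟩ := exists_min_image Q f hne
    have h1 := ih (Q.erase q) (by rw [card_erase_of_mem hq]; omega)
      (fun Q' hQ' => h Q' (hQ'.trans (erase_subset _ _)))
    have h2 := h Q subset_rfl (f q) hmin
    rw [← Finset.add_sum_erase Q _ hq, harmonic_succ]
    push_cast
    rw [hQ] at h2
    push_cast at h2
    have h3 : (f q : ℝ) ^ 2 ≤ K * ((n : ℝ) + 1)⁻¹ := by
      rw [← div_eq_mul_inv, le_div_iff₀ (by positivity)]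
      linarith
    linarith

/-- Points of `B × B` on the line of slope `q`, in the right half plane. -/
noncomputable def rp (B : Finset ℝ) (q : ℝ) : Finset (ℝ × ℝ) := {p ∈ B ×ˢ B | 0 < p.1 ∧ p.2 = q * p.1}

lemma sol_aux (B : Finset ℝ) (t : ℕ) (Q : Finset ℝ) : (∀ q ∈ Q, t ≤ #(rp B q)) →
    ∀ M, (∀ q ∈ Q, q < M) → t ≤ #(rp B M) →
    #Q * t ^ 2 ≤ #{z ∈ (B + B) ×ˢ (B + B) | 0 < z.1 ∧ z.2 < M * z.1} := by
  induction Q using Finset.induction_on_max with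
  | empty => intro _ M _ _; simp
  | insert m Q hm ih =>
    intro h M hM htM
    have h1 := ih (fun q hq => h q (mem_insert_of_mem hq)) m hm (h m (mem_insert_self _ _))
    have hmM := hM m (mem_insert_self _ _)
    have htm := h m (mem_insert_self _ _)
    rw [card_insert_of_notMem (fun hh => lt_irrefl _ (hm m hh))]
    set T := ((rp B m) ×ˢ (rp B M)).image (fun w => w.1 + w.2) with hT
    have hTc : #T = #(rp B m) * #(rp B M) := by
      rw [hT, card_image_of_injOn, card_product]
      rintro ⟨⟨a, b⟩, c, d⟩ h1 ⟨⟨a', b'⟩, c', d'⟩ h2 h3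
      simp only [coe_product, rp, Set.mem_prod, mem_coe, mem_filter, mem_product] at h1 h2
      simp only [Prod.mk_add_mk, Prod.mk.injEq] at h3
      obtain ⟨⟨_, _, rfl⟩, _, _, rfl⟩ := h1
      obtain ⟨⟨_, _, rfl⟩, _, _, rfl⟩ := h2
      obtain ⟨e1, e2⟩ := h3
      have e3 : (M - m) * (c - c') = 0 := by linear_combination e2 - m * e1
      rcases mul_eq_zero.1 e3 with e | e
      · linarith
      · obtain rfl : c = c' := by linarith
        obtain rfl : a = a' := by linarith
        rfl
    have hd : Disjoint {z ∈ (B + B) ×ˢ (B + B) | 0 < z.1 ∧ z.2 < m * z.1} T := by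
      rw [Finset.disjoint_left]
      intro z hz hz'
      simp only [hT, mem_image, mem_product, rp, mem_filter] at hz hz'
      obtain ⟨⟨⟨a, b⟩, c, d⟩, ⟨⟨_, h3, h4⟩, _, h5, h6⟩, rfl⟩ := hz'
      simp only [Prod.mk_add_mk] at *
      subst h4 h6
      nlinarith [hz.2.2, mul_pos (sub_pos.2 hmM) h5]
    have hsub : {z ∈ (B + B) ×ˢ (B + B) | 0 < z.1 ∧ z.2 < m * z.1} ∪ T ⊆
        {z ∈ (B + B) ×ˢ (B + B) | 0 < z.1 ∧ z.2 < M * z.1} := by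
      intro z hz
      rcases mem_union.1 hz with hz | hz
      · simp only [mem_filter] at hz ⊢
        refine ⟨hz.1, hz.2.1, hz.2.2.trans ?_⟩
        exact mul_lt_mul_of_pos_right hmM hz.2.1
      · simp only [hT, mem_image, mem_product, rp, mem_filter] at hz ⊢
        obtain ⟨⟨⟨a, b⟩, c, d⟩, ⟨⟨hab, h3, h4⟩, hcd, h5, h6⟩, rfl⟩ := hz
        simp only [Prod.mk_add_mk] at *
        refine ⟨⟨add_mem_add hab.1 hcd.1, add_mem_add hab.2 hcd.2⟩, by linarith, ?_⟩
        subst h4 h6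
        nlinarith [mul_pos (sub_pos.2 hmM) h3]
    have := card_le_card hsub
    rw [card_union_of_disjoint hd, hTc] at this
    nlinarith [Nat.mul_le_mul htm htM]

lemma card_le_add (B : Finset ℝ) : #B ≤ #(B + B) := by
  rcases B.eq_empty_or_nonempty with rfl | h
  · simp
  · exact card_le_card_add_right h

lemma sol (B : Finset ℝ) (t : ℕ) (Q : Finset ℝ) (h : ∀ q ∈ Q, t ≤ #(rp B q)) :
    (#Q : ℝ) * (t : ℝ) ^ 2 ≤ 2 * (#(B + B) : ℝ) ^ 2 := by
  rcases Q.eq_empty_or_nonempty with rfl | hne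
  · simp
  have hM := Q.max'_mem hne
  have h1 := sol_aux B t (Q.erase (Q.max' hne)) (fun q hq => h q (mem_of_mem_erase hq))
    (Q.max' hne) (fun q hq => Q.lt_max'_of_mem_erase_max' hne hq) (h _ hM)
  have h2 := h1.trans (card_filter_le _ _)
  rw [card_product, card_erase_of_mem hM] at h2
  have h3 : t ≤ #B := by
    refine (h _ hM).trans ?_
    refine card_le_card_of_injOn Prod.fst ?_ ?_
    · intro p hp
      simp only [rp, coe_filter, mem_product, Set.mem_ofPred_eq] at hp
      exact hp.1.1
    · rintro ⟨a, b⟩ hp ⟨a', b'⟩ hp' e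
      simp only [rp, coe_filter, mem_product, Set.mem_ofPred_eq] at hp hp' e
      rw [hp.2.2, hp'.2.2, e]
  have h4 := h3.trans (card_le_add B)
  have h5 := card_pos.2 hne
  obtain ⟨k, hk⟩ : ∃ k, #Q = k + 1 := ⟨#Q - 1, by omega⟩
  rw [hk] at h2 ⊢
  simp only [Nat.add_sub_cancel] at h2
  have : (k + 1) * t ^ 2 ≤ 2 * #(B + B) ^ 2 := by nlinarith [Nat.mul_le_mul h4 h4]
  exact_mod_cast this

/-- number of representations `b.2 = q * b.1` -/
noncomputable def rr (B : Finset ℝ) (q : ℝ) : ℕ := #{p ∈ B ×ˢ B | p.2 = q * p.1}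

lemma rr_le (B : Finset ℝ) (h0 : (0:ℝ) ∉ B) (q : ℝ) : rr B q ≤ #(rp B q) + #(rp (-B) q) := by
  have : #(rp (-B) q) = #{p ∈ B ×ˢ B | p.1 < 0 ∧ p.2 = q * p.1} := by
    refine card_bij' (fun p _ => -p) (fun p _ => -p) ?_ ?_ ?_ ?_
    · intro p hp
      simp only [rp, mem_filter, mem_product, mem_neg', Prod.fst_neg, Prod.snd_neg] at hp ⊢
      exact ⟨hp.1, by linarith, by linarith⟩
    · intro p hp
      simp only [rp, mem_filter, mem_product, mem_neg', Prod.fst_neg, Prod.snd_neg, neg_neg] at hp ⊢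
      exact ⟨hp.1, by linarith, by linarith⟩
    · simp
    · simp
  rw [this, rp, rr]
  refine le_trans (card_le_card ?_) (card_union_le _ _)
  intro p hp
  simp only [mem_filter, mem_union, mem_product] at hp ⊢
  rcases lt_trichotomy p.1 0 with h | h | h
  · exact Or.inr ⟨hp.1, h, hp.2⟩
  · exact absurd (h ▸ hp.1.1) h0
  · exact Or.inl ⟨hp.1, h, hp.2⟩

lemma sum_rr (B : Finset ℝ) (h0 : (0:ℝ) ∉ B) (Q : Finset ℝ) :
    ∑ q ∈ Q, (rr B q : ℝ) ^ 2 ≤ 8 * (#(B + B) : ℝ) ^ 2 * ((harmonic #Q : ℚ) : ℝ) := by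
  have h1 := harm (fun q => #(rp B q)) (2 * (#(B + B) : ℝ) ^ 2) _ Q rfl
    (fun Q' _ t h => sol B t Q' h)
  have h2 := harm (fun q => #(rp (-B) q)) (2 * (#(-B + -B) : ℝ) ^ 2) _ Q rfl
    (fun Q' _ t h => sol (-B) t Q' h)
  have h3 : #(-B + -B) = #(B + B) := by
    rw [← neg_add, card_neg]
  rw [h3] at h2
  have h4 : ∑ q ∈ Q, (rr B q : ℝ) ^ 2 ≤
      ∑ q ∈ Q, (2 * (#(rp B q) : ℝ) ^ 2 + 2 * (#(rp (-B) q) : ℝ) ^ 2) := by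
    refine Finset.sum_le_sum fun q _ => ?_
    have : (rr B q : ℝ) ≤ #(rp B q) + #(rp (-B) q) := by exact_mod_cast rr_le B h0 q
    have h0 : (0:ℝ) ≤ rr B q := by positivity
    nlinarith [sq_nonneg ((#(rp B q) : ℝ) - #(rp (-B) q))]
  rw [Finset.sum_add_distrib, ← Finset.mul_sum, ← Finset.mul_sum] at h4
  linarith

noncomputable def ci (A : Finset ℝ) (m : ℕ) (a : ℝ) : ℕ := #{b ∈ A | b < a} / m

lemma ci_mono (A : Finset ℝ) (m : ℕ) {a b : ℝ} (h : a ≤ b) : ci A m a ≤ ci A m b := by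
  refine Nat.div_le_div_right (card_le_card ?_)
  intro c hc
  simp only [mem_filter] at hc ⊢
  exact ⟨hc.1, hc.2.trans_le h⟩

lemma ci_le (A : Finset ℝ) (m : ℕ) {a : ℝ} (h : a ∈ A) : ci A m a ≤ (#A - 1) / m := by
  refine Nat.div_le_div_right ?_
  rw [← card_erase_of_mem h]
  refine card_le_card ?_
  intro c hc
  simp only [mem_filter] at hc
  exact mem_erase.2 ⟨hc.2.ne, hc.1⟩

lemma ci_fiber (A : Finset ℝ) (m : ℕ) (hm : 0 < m) (k : ℕ) : #{b ∈ A | ci A m b = k} ≤ m := by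
  have : #(Finset.Ico (k * m) (k * m + m)) = m := by simp
  refine le_of_le_of_eq ?_ this
  refine card_le_card_of_injOn (fun b => #{c ∈ A | c < b}) ?_ ?_
  · intro b hb
    replace hb := mem_filter.1 (mem_coe.1 hb)
    unfold ci at hb
    simp only [coe_Ico, Set.mem_Ico]
    have h1 := Nat.div_add_mod #{c ∈ A | c < b} m
    have h2 := Nat.mod_lt #{c ∈ A | c < b} hm
    rw [hb.2, mul_comm] at h1
    generalize #{c ∈ A | c < b} % m = r at h1 h2
    generalize k * m = v at h1 ⊢
    constructor <;> omega
  · have key : ∀ b ∈ A, ∀ b', b < b' → #{c ∈ A | c < b} < #{c ∈ A | c < b'} := by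
      intro b hb b' hlt
      refine card_lt_card ?_
      rw [Finset.ssubset_iff_of_subset]
      · exact ⟨b, by simp [hb, hlt], by simp⟩
      · intro c hc
        simp only [mem_filter] at hc ⊢
        exact ⟨hc.1, hc.2.trans hlt⟩
    intro b hb b' hb' e
    simp only [coe_filter, Set.mem_ofPred_eq] at hb hb' e
    rcases lt_trichotomy b b' with h | h | h
    · exact absurd e (key b hb.1 b' h).ne
    · exact h
    · exact absurd e (key b' hb'.1 b h).ne'

lemma ci_pairs (A : Finset ℝ) (m : ℕ) (hm : 0 < m) :
    #{z ∈ A ×ˢ A | ci A m z.1 = ci A m z.2} ≤ #A * m := by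
  rw [fiber_count A (ci A m) (ci A m) (A.image (ci A m)) (fun p hp => mem_image_of_mem _ hp),
    Finset.card_eq_sum_card_image (ci A m) A, Finset.sum_mul]
  exact Finset.sum_le_sum fun s _ => Nat.mul_le_mul_left _ (ci_fiber A m hm s)

noncomputable def EE (A : Finset ℝ) (q : ℝ) : ℕ :=
  #{z ∈ (A ×ˢ A) ×ˢ (A ×ˢ A) | z.1.1 - q * z.1.2 = z.2.1 - q * z.2.2}

noncomputable def OD (A : Finset ℝ) (m : ℕ) (q : ℝ) : Finset ((ℝ × ℝ) × (ℝ × ℝ)) :=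
  {z ∈ (A ×ˢ A) ×ˢ (A ×ˢ A) | z.1 ≠ z.2 ∧ z.1.1 - q * z.1.2 = z.2.1 - q * z.2.2 ∧
    ci A m z.1.1 = ci A m z.2.1 ∧ ci A m z.1.2 = ci A m z.2.2}

lemma EE_le (A : Finset ℝ) (m : ℕ) (q : ℝ) (hq : q ≠ 0) :
    EE A q ≤ (2 * ((#A - 1) / m) + 1) * (#(OD A m q) + #A ^ 2) := by
  classical
  set K := (#A - 1) / m with hK
  obtain ⟨l, hl, hl2⟩ : ∃ l : ℝ × ℝ → ℕ, (∀ p ∈ A ×ˢ A, l p < 2 * K + 1) ∧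
      ∀ p ∈ A ×ˢ A, ∀ p' ∈ A ×ˢ A, p.1 - q * p.2 = p'.1 - q * p'.2 → l p = l p' →
        ci A m p.1 = ci A m p'.1 ∧ ci A m p.2 = ci A m p'.2 := by
    rcases lt_or_gt_of_ne hq with h | h
    · refine ⟨fun p => ci A m p.1 + (K - ci A m p.2), ?_, ?_⟩
      · intro p hp
        have h1 := ci_le A m (mem_product.1 hp).1
        have h2 := ci_le A m (mem_product.1 hp).2
        simp only
        omega
      · intro p hp p' hp' e e2
        have h1 := ci_le A m (mem_product.1 hp).2
        have h2 := ci_le A m (mem_product.1 hp').2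
        simp only at e2
        rcases le_total p.2 p'.2 with h3 | h3
        · have h4 : p'.1 ≤ p.1 := by nlinarith
          have := ci_mono A m h3
          have := ci_mono A m h4
          omega
        · have h4 : p.1 ≤ p'.1 := by nlinarith
          have := ci_mono A m h3
          have := ci_mono A m h4
          omega
    · refine ⟨fun p => ci A m p.1 + ci A m p.2, ?_, ?_⟩
      · intro p hp
        have h1 := ci_le A m (mem_product.1 hp).1
        have h2 := ci_le A m (mem_product.1 hp).2
        simp only
        omega
      · intro p hp p' hp' e e2
        simp only at e2
        rcases le_total p.2 p'.2 with h3 | h3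
        · have h4 : p.1 ≤ p'.1 := by nlinarith
          have := ci_mono A m h3
          have := ci_mono A m h4
          omega
        · have h4 : p'.1 ≤ p.1 := by nlinarith
          have := ci_mono A m h3
          have := ci_mono A m h4
          omega
  have h1 := cs_label (A ×ˢ A) (fun p => p.1 - q * p.2) l _ hl
  refine h1.trans (Nat.mul_le_mul_left _ ?_)
  have h2 : #((A ×ˢ A).image (fun p => (p, p))) ≤ #A ^ 2 := by
    refine card_image_le.trans ?_
    rw [card_product, pow_two]
  refine le_trans (le_trans (card_le_card ?_) (card_union_le _ _)) (Nat.add_le_add_left h2 _)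
  rintro ⟨p, p'⟩ hz
  rw [mem_filter, mem_product] at hz
  rw [mem_union]
  obtain ⟨⟨hp, hp'⟩, e, e2⟩ := hz
  simp only at hp hp' e e2
  by_cases hpp : p = p'
  · right
    subst hpp
    exact mem_image_of_mem (fun p => (p, p)) hp
  · left
    rw [OD, mem_filter, mem_product]
    exact ⟨⟨hp, hp'⟩, hpp, e, hl2 p hp p' hp' e e2⟩

lemma sum_OD (A : Finset ℝ) (m : ℕ) (hm : 0 < m) (Q : Finset ℝ) :
    ∑ q ∈ Q, #(OD A m q) ≤ (#A * m) ^ 2 := by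
  classical
  rw [← card_biUnion]
  · have : #({z ∈ A ×ˢ A | ci A m z.1 = ci A m z.2} ×ˢ {z ∈ A ×ˢ A | ci A m z.1 = ci A m z.2})
        ≤ (#A * m) ^ 2 := by
      rw [card_product, ← pow_two]
      exact Nat.pow_le_pow_left (ci_pairs A m hm) 2
    refine le_trans ?_ this
    refine card_le_card_of_injOn (fun z => ((z.1.1, z.2.1), (z.1.2, z.2.2))) ?_ ?_
    · intro z hz
      simp only [OD, coe_biUnion, Set.mem_iUnion, coe_filter, mem_product, Set.mem_ofPred_eq] at hz
      obtain ⟨q, _, h⟩ := hz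
      simp only [coe_product, Set.mem_prod, coe_filter, mem_product, Set.mem_ofPred_eq]
      tauto
    · rintro ⟨⟨a, b⟩, c, d⟩ _ ⟨⟨a', b'⟩, c', d'⟩ _ h
      simp only [Prod.mk.injEq] at h ⊢
      tauto
  · intro q _ q' _ hne
    rw [Function.onFun, Finset.disjoint_left]
    rintro ⟨⟨a, b⟩, c, d⟩ h h'
    simp only [OD, mem_filter] at h h'
    have h1 := h.2.2.1
    have h2 := h'.2.2.1
    have h3 : (q - q') * (b - d) = 0 := by linear_combination h2 - h1
    rcases mul_eq_zero.1 h3 with h3 | h3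
    · exact hne (by linarith)
    · obtain rfl : b = d := by linarith
      exact h.2.1 (by rw [show a = c by linarith])

lemma st (A : Finset ℝ) (t : ℕ) (Q : Finset ℝ) (h0 : ∀ q ∈ Q, q ≠ 0) (hc : #Q ≤ #A ^ 2)
    (h : ∀ q ∈ Q, t ≤ EE A q) : (#Q : ℝ) * (t : ℝ) ^ 2 ≤ 225 * (#A : ℝ) ^ 6 := by
  rcases Q.eq_empty_or_nonempty with rfl | hne
  · simp
  have hQ := card_pos.2 hne
  set m := Nat.sqrt #Q with hmd
  set n := #A with hn
  have hm : 0 < m := Nat.sqrt_pos.2 hQ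
  have hm1 : m * m ≤ #Q := Nat.sqrt_le _
  have hm2 : #Q < (m + 1) * (m + 1) := Nat.lt_succ_sqrt _
  have hmn : m ≤ n := by nlinarith
  have h1 : #Q * t ≤ ∑ q ∈ Q, EE A q := by
    rw [← smul_eq_mul]
    exact Finset.card_nsmul_le_sum _ _ _ h
  have h2 : ∑ q ∈ Q, EE A q ≤ (2 * ((n - 1) / m) + 1) * ((n * m) ^ 2 + #Q * n ^ 2) := by
    refine (Finset.sum_le_sum fun q hq => EE_le A m q (h0 q hq)).trans ?_
    rw [← Finset.mul_sum, Finset.sum_add_distrib, sum_const, smul_eq_mul]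
    exact Nat.mul_le_mul_left _ (Nat.add_le_add_right (sum_OD A m hm Q) _)
  have h3 : m * (2 * ((n - 1) / m) + 1) ≤ 3 * n := by
    have := Nat.mul_div_le (n - 1) m
    have h4 : n - 1 ≤ n := Nat.sub_le _ _
    nlinarith
  have h4 : #Q ≤ 4 * m ^ 2 := by nlinarith
  have h5 : m * (#Q * t) ≤ 15 * n ^ 3 * m ^ 2 := by
    calc m * (#Q * t) ≤ m * ((2 * ((n - 1) / m) + 1) * ((n * m) ^ 2 + #Q * n ^ 2)) :=
          Nat.mul_le_mul_left _ (h1.trans h2)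
      _ = (m * (2 * ((n - 1) / m) + 1)) * ((n * m) ^ 2 + #Q * n ^ 2) := by ring
      _ ≤ (3 * n) * ((n * m) ^ 2 + (4 * m ^ 2) * n ^ 2) := by gcongr
      _ = 15 * n ^ 3 * m ^ 2 := by ring
  have h6 : #Q * t ≤ 15 * n ^ 3 * m := by
    have h7 : m * (#Q * t) ≤ m * (15 * n ^ 3 * m) := by linarith
    exact Nat.le_of_mul_le_mul_left h7 hm
  have h7 : #Q * (#Q * t ^ 2) ≤ #Q * (225 * n ^ 6) := by
    calc #Q * (#Q * t ^ 2) = (#Q * t) ^ 2 := by ring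
      _ ≤ (15 * n ^ 3 * m) ^ 2 := Nat.pow_le_pow_left h6 2
      _ = (m * m) * (225 * n ^ 6) := by ring
      _ ≤ _ := Nat.mul_le_mul_right _ hm1
  exact_mod_cast Nat.le_of_mul_le_mul_left h7 hQ

lemma sum_EE (A : Finset ℝ) (Q : Finset ℝ) (h0 : ∀ q ∈ Q, q ≠ 0) (hc : #Q ≤ #A ^ 2) :
    ∑ q ∈ Q, (EE A q : ℝ) ^ 2 ≤ 225 * (#A : ℝ) ^ 6 * ((harmonic #Q : ℚ) : ℝ) :=
  harm (fun q => EE A q) _ _ Q rfl (fun Q' hQ' t h => st A t Q' (fun q hq => h0 q (hQ' hq))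
    ((card_le_card hQ').trans hc) h)

lemma harm_bound (n k : ℕ) (hn : 2 ≤ n) (hk : k ≤ n ^ 2) :
    ((harmonic k : ℚ) : ℝ) ≤ 4 * Real.logb 2 n := by
  have hn' : (2:ℝ) ≤ n := by exact_mod_cast hn
  have hl : 1 ≤ Real.logb 2 n := by
    rw [Real.le_logb_iff_rpow_le (by norm_num) (by linarith)]
    simpa using hn'
  have h2 : Real.log n ≤ Real.logb 2 n := by
    rw [Real.logb, le_div_iff₀ (Real.log_pos (by norm_num))]
    have : Real.log 2 ≤ 1 := by linarith [Real.log_two_lt_d9]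
    have : 0 ≤ Real.log n := Real.log_nonneg (by linarith)
    nlinarith
  have h1 := harmonic_le_one_add_log k
  have h3 : Real.log k ≤ 2 * Real.log n := by
    rcases Nat.eq_zero_or_pos k with rfl | hk0
    · simp; exact Real.log_nonneg (by linarith)
    · have : Real.log k ≤ Real.log ((n:ℝ) ^ 2) :=
        Real.log_le_log (by exact_mod_cast hk0) (by exact_mod_cast hk)
      simpa [Real.log_pow] using this
  linarith

/-- The collision count is at most the weighted sum of line counts. -/
lemma N_le (A : Finset ℝ) (x : ℝ) (hx : ∀ a ∈ A, a + x ≠ 0) (Q : Finset ℝ)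
    (hQ : ∀ a ∈ A, ∀ a' ∈ A, (a' + x) / (a + x) ∈ Q) :
    #{z ∈ (A ×ˢ A ×ˢ A) ×ˢ (A ×ˢ A ×ˢ A) |
      (z.1.1 + x) * (z.1.2.1 + z.1.2.2) = (z.2.1 + x) * (z.2.2.1 + z.2.2.2)} ≤
    ∑ q ∈ Q, rr (A.image (· + x)) q * EE A q := by
  classical
  rw [Finset.card_eq_sum_card_fiberwise (f := fun z => (z.2.1 + x) / (z.1.1 + x)) (t := Q)]
  · refine Finset.sum_le_sum fun q _ => ?_
    refine le_trans ?_ (Nat.mul_le_mul_left _ (neg_count (A ×ˢ A) (fun p => p.1 - q * p.2)))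
    rw [rr, ← card_product]
    refine card_le_card_of_injOn
      (fun z => ((z.1.1 + x, z.2.1 + x), ((z.1.2.1, z.2.2.1), (z.1.2.2, z.2.2.2)))) ?_ ?_
    · rintro ⟨⟨a, b, c⟩, a', b', c'⟩ hz
      simp only [coe_filter, mem_filter, mem_product, Set.mem_ofPred_eq] at hz
      obtain ⟨⟨⟨⟨ha, hb, hc⟩, ha', hb', hc'⟩, e⟩, e2⟩ := hz
      have hax := hx a ha
      rw [div_eq_iff hax] at e2
      rw [e2] at e
      have e3 : b + c = q * (b' + c') := mul_left_cancel₀ hax (by linear_combination e)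
      simp only [coe_product, Set.mem_prod, coe_filter, mem_product, Set.mem_ofPred_eq, mem_image]
      exact ⟨⟨⟨⟨a, ha, rfl⟩, ⟨a', ha', rfl⟩⟩, e2⟩, ⟨⟨hb, hb'⟩, hc, hc'⟩, by linear_combination e3⟩
    · rintro ⟨⟨a, b, c⟩, a', b', c'⟩ _ ⟨⟨a1, b1, c1⟩, a1', b1', c1'⟩ _ h
      simp only [Prod.mk.injEq, add_left_inj] at h ⊢
      tauto
  · rintro ⟨⟨a, b, c⟩, a', b', c'⟩ hz
    simp only [coe_filter, mem_product, Set.mem_ofPred_eq] at hz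
    exact hQ a hz.1.1.1 a' hz.1.2.1

theorem stmt15 : ∃ c > (0:ℝ), ∀ (A : Finset ℝ) (x : ℝ), 2 ≤ A.card →
    (∀ a ∈ A, a + x ≠ 0) →
    c * ((A.card : ℝ)^3 / Real.logb 2 (A.card : ℝ)) ≤
      (((A ×ˢ A ×ˢ A).image (fun t => (t.1 + x) * (t.2.1 + t.2.2))).card : ℝ) *
        ((A + A).card : ℝ) := by
  refine ⟨1 / 200, by norm_num, fun A x hA hx => ?_⟩
  set S := (A ×ˢ A ×ˢ A).image (fun t => (t.1 + x) * (t.2.1 + t.2.2)) with hS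
  set Q := (A ×ˢ A).image (fun p => (p.2 + x) / (p.1 + x)) with hQ
  set B := A.image (· + x) with hB
  have hQc : #Q ≤ #A ^ 2 := by
    refine card_image_le.trans ?_
    rw [card_product, pow_two]
  have hQ0 : ∀ q ∈ Q, q ≠ 0 := by
    intro q hq
    obtain ⟨p, hp, rfl⟩ := mem_image.1 hq
    rw [mem_product] at hp
    exact div_ne_zero (hx _ hp.2) (hx _ hp.1)
  have hB0 : (0:ℝ) ∉ B := by
    intro h
    obtain ⟨a, ha, e⟩ := mem_image.1 h
    exact hx a ha e
  have hBB : #(B + B) ≤ #(A + A) := by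
    have : B + B ⊆ (A + A).image (· + (x + x)) := by
      intro s hs
      obtain ⟨u, hu, v, hv, rfl⟩ := mem_add.1 hs
      obtain ⟨a, ha, rfl⟩ := mem_image.1 hu
      obtain ⟨b, hb, rfl⟩ := mem_image.1 hv
      exact mem_image.2 ⟨a + b, add_mem_add ha hb, by ring⟩
    exact (card_le_card this).trans card_image_le
  have h1 := cs_count (A ×ˢ A ×ˢ A) (fun t => (t.1 + x) * (t.2.1 + t.2.2)) S
    (fun p hp => mem_image_of_mem (fun t : ℝ × ℝ × ℝ => (t.1 + x) * (t.2.1 + t.2.2)) hp)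
  have h2 := N_le A x hx Q (fun a ha a' ha' => mem_image.2 ⟨(a, a'), mem_product.2 ⟨ha, ha'⟩, rfl⟩)
  have h3 := h1.trans (Nat.mul_le_mul_left _ h2)
  rw [card_product, card_product] at h3
  have h4 : ((#A : ℝ) * (#A * #A)) ^ 2 ≤ #S * ∑ q ∈ Q, (rr B q : ℝ) * (EE A q : ℝ) := by
    exact_mod_cast h3
  have h5 := Finset.sum_mul_sq_le_sq_mul_sq Q (fun q => (rr B q : ℝ)) (fun q => (EE A q : ℝ))
  have h6 := sum_rr B hB0 Q
  have h7 := sum_EE A Q hQ0 hQc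
  have h8 := harm_bound #A #Q hA hQc
  have hH0 : (0:ℝ) ≤ ((harmonic #Q : ℚ) : ℝ) := by
    have : (0:ℚ) ≤ harmonic #Q := by
      unfold harmonic
      exact Finset.sum_nonneg fun i _ => by positivity
    exact_mod_cast this
  set N := ∑ q ∈ Q, (rr B q : ℝ) * (EE A q : ℝ) with hN
  set H := ((harmonic #Q : ℚ) : ℝ) with hH
  set l := Real.logb 2 (#A : ℝ) with hl
  have hn' : (2:ℝ) ≤ #A := by exact_mod_cast hA
  have hlp : 0 < l := Real.logb_pos (by norm_num) (by linarith)
  have hBB' : (#(B + B) : ℝ) ≤ #(A + A) := by exact_mod_cast hBB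
  have hN2 : N ^ 2 ≤ (50 * #(A + A) * (#A : ℝ) ^ 3 * H) ^ 2 := by
    calc N ^ 2 ≤ (8 * (#(B + B) : ℝ) ^ 2 * H) * (225 * (#A : ℝ) ^ 6 * H) :=
          h5.trans (mul_le_mul h6 h7 (Finset.sum_nonneg fun i _ => by positivity) (by positivity))
      _ ≤ (8 * (#(A + A) : ℝ) ^ 2 * H) * (225 * (#A : ℝ) ^ 6 * H) := by gcongr
      _ = 1800 * (#(A + A) * (#A : ℝ) ^ 3 * H) ^ 2 := by ring
      _ ≤ 2500 * (#(A + A) * (#A : ℝ) ^ 3 * H) ^ 2 := by gcongr; norm_num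
      _ = _ := by ring
  have hN3 : N ≤ 50 * #(A + A) * (#A : ℝ) ^ 3 * H := by
    exact le_of_sq_le_sq hN2 (by positivity)
  have h9 : (#A : ℝ) ^ 3 * (#A : ℝ) ^ 3 ≤ (#A : ℝ) ^ 3 * (200 * (#S * #(A + A)) * l) := by
    calc (#A : ℝ) ^ 3 * (#A : ℝ) ^ 3 = ((#A : ℝ) * (#A * #A)) ^ 2 := by ring
      _ ≤ #S * N := h4
      _ ≤ #S * (50 * #(A + A) * (#A : ℝ) ^ 3 * (4 * l)) := by
        refine mul_le_mul_of_nonneg_left (hN3.trans ?_) (by positivity)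
        gcongr
      _ = _ := by ring
  have h10 := le_of_mul_le_mul_left h9 (by positivity)
  rw [← mul_div_assoc, div_le_iff₀ hlp]
  linarith
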